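/- arXiv:2201.09175 — 6 statements merged into one kernel-verified Lean document; each statement's English description precedes it below -/
import Mathlib

section
/- Let N and k be positive integers and let A₁, A₂, …, A_k be real positive definite N×N matrices such that det(A₁) = det(A₂) = … = det(A_k) = c for some real c > 0. Then det((1/k)·(A₁ + A₂ + … + A_k)) ≥ c, and equality holds if and only if A₁ = A₂ = … = A_k. -/
namespace Matrix

variable {n : Type*} [Fintype n] [DecidableEq n]

theorem PosDef.log_det_lt_trace_sub_card {M : Matrix n n ℝ} (hM : M.PosDef) (h : M ≠ 1) :
    Real.log M.det < M.trace - Fintype.card n := by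
  have hpos := hM.eigenvalues_pos
  have hne : ∃ i, hM.1.eigenvalues i ≠ 1 := by
    contrapose! h
    rw [hM.1.spectral_theorem, show hM.1.eigenvalues = fun _ ↦ 1 from funext h]
    simp
  obtain ⟨i, hi⟩ := hne
  have htr : M.trace - Fintype.card n = ∑ i, (hM.1.eigenvalues i - 1) := by
    simp [hM.1.trace_eq_sum_eigenvalues]
  have hdet : Real.log M.det = ∑ i, Real.log (hM.1.eigenvalues i) := by
    rw [hM.1.det_eq_prod_eigenvalues, ← Real.log_prod fun i _ ↦ (hpos i).ne']
    rfl
  rw [htr, hdet]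
  exact Finset.sum_lt_sum (fun j _ ↦ Real.log_le_sub_one_of_pos (hpos j))
    ⟨i, Finset.mem_univ i, Real.log_lt_sub_one_of_pos (hpos i) hi⟩

open scoped MatrixOrder in
theorem PosDef.log_det_sub_log_det_lt {A S : Matrix n n ℝ} (hA : A.PosDef) (hS : S.PosDef)
    (h : A ≠ S) :
    Real.log A.det - Real.log S.det < (A * S⁻¹).trace - Fintype.card n := by
  obtain ⟨y, rfl⟩ := CStarAlgebra.nonneg_iff_eq_star_mul_self.mp hS.posSemidef.nonneg
  have hdet : (star y * y).det ≠ 0 := hS.det_pos.ne'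
  have hdy : y.det ≠ 0 := by
    rw [det_mul] at hdet
    exact right_ne_zero_of_mul hdet
  have hy : IsUnit y.det := hdy.isUnit
  have hyH : IsUnit yᴴ.det := by simpa using hdy
  have hM : (y⁻¹ᴴ * A * y⁻¹).PosDef := hA.conjTranspose_mul_mul_same <|
    mulVec_injective_of_isUnit <| by simpa [isUnit_iff_isUnit_det] using hdy
  have hne : y⁻¹ᴴ * A * y⁻¹ ≠ 1 := by
    contrapose! h
    calc A = yᴴ * (y⁻¹ᴴ * A * y⁻¹) * y := by
          rw [conjTranspose_nonsing_inv, mul_assoc, nonsing_inv_mul_cancel_right _ _ hy,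
            mul_nonsing_inv_cancel_left _ _ hyH]
      _ = star y * y := by rw [h, mul_one, star_eq_conjTranspose]
  have htr : (y⁻¹ᴴ * A * y⁻¹).trace = (A * (star y * y)⁻¹).trace := by
    rw [star_eq_conjTranspose, Matrix.mul_inv_rev, trace_mul_comm, conjTranspose_nonsing_inv,
      ← mul_assoc, trace_mul_comm]
  have hlog : Real.log (y⁻¹ᴴ * A * y⁻¹).det = Real.log A.det - Real.log (star y * y).det := by
    rw [← Real.log_div hA.det_pos.ne' hdet]
    congr 1
    simp only [det_mul, det_conjTranspose, det_nonsing_inv, star_eq_conjTranspose,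
      Ring.inverse_eq_inv', star_trivial]
    field_simp
  rw [← htr, ← hlog]
  exact hM.log_det_lt_trace_sub_card hne

theorem PosDef.log_det_sub_log_det_le {A S : Matrix n n ℝ} (hA : A.PosDef) (hS : S.PosDef) :
    Real.log A.det - Real.log S.det ≤ (A * S⁻¹).trace - Fintype.card n := by
  obtain rfl | h := eq_or_ne A S
  · simp [mul_nonsing_inv _ hA.det_pos.ne'.isUnit]
  · exact (hA.log_det_sub_log_det_lt hS h).le

end Matrix


/-- Besson–Courtois–Gallot averaged-determinant inequality: if `A₁, …, A_k` are
real positive definite `N × N` matrices all of determinant `c > 0`, then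
`det ((1/k) • ∑ Aᵢ) ≥ c`, with equality iff all the `Aᵢ` are equal. -/
theorem det_avg_posDef (N k : ℕ) (hN : 0 < N) (hk : 0 < k)
    (A : Fin k → Matrix (Fin N) (Fin N) ℝ)
    (hA : ∀ i, (A i).PosDef)
    (c : ℝ) (hc : 0 < c) (hdet : ∀ i, (A i).det = c) :
    c ≤ (((k : ℝ)⁻¹) • ∑ i, A i).det ∧
      ((((k : ℝ)⁻¹) • ∑ i, A i).det = c ↔ ∀ i j, A i = A j) := by
  have : Nonempty (Fin k) := ⟨⟨0, hk⟩⟩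
  have hk' : (0 : ℝ) < k := by exact_mod_cast hk
  set S : Matrix (Fin N) (Fin N) ℝ := (k : ℝ)⁻¹ • ∑ i, A i with hSdef
  have hS : S.PosDef :=
    (Matrix.posDef_sum Finset.univ_nonempty fun i _ ↦ hA i).smul (inv_pos.mpr hk')
  have hsum : ∑ i, A i = (k : ℝ) • S := by rw [hSdef, smul_inv_smul₀ hk'.ne']
  have htr : ∑ i, ((A i * S⁻¹).trace - (N : ℝ)) = 0 := by
    rw [Finset.sum_sub_distrib, ← Matrix.trace_sum, ← Finset.sum_mul, hsum, smul_mul_assoc,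
      Matrix.mul_nonsing_inv _ hS.det_pos.ne'.isUnit]
    simp
  have hle : ∀ i, Real.log c - Real.log S.det ≤ (A i * S⁻¹).trace - (N : ℝ) := fun i ↦ by
    simpa [hdet i] using (hA i).log_det_sub_log_det_le hS
  refine ⟨?_, fun heq ↦ ?_, fun h ↦ ?_⟩
  · have hlog := Finset.sum_le_sum fun i (_ : i ∈ Finset.univ) ↦ hle i
    rw [htr, Finset.sum_const, Finset.card_univ, Fintype.card_fin, nsmul_eq_mul] at hlog
    exact (Real.log_le_log_iff hc hS.det_pos).mp
      (sub_nonpos.mp (nonpos_of_mul_nonpos_right hlog hk'))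
  · have hAS : ∀ i, A i = S := fun i ↦ by
      by_contra hne
      have hlt := (hA i).log_det_sub_log_det_lt hS hne
      rw [hdet i, Fintype.card_fin] at hlt
      have hlog := Finset.sum_lt_sum (fun j _ ↦ hle j) ⟨i, Finset.mem_univ i, hlt⟩
      simp [htr, heq] at hlog
    exact fun i j ↦ (hAS i).trans (hAS j).symm
  · have hconst : ∑ i, A i = (k : ℝ) • A ⟨0, hk⟩ := by
      simp [Finset.sum_congr rfl fun i _ ↦ h i ⟨0, hk⟩, Nat.cast_smul_eq_nsmul]
    rw [hSdef, hconst, inv_smul_smul₀ hk'.ne', hdet]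
end

section
/- Let N, n, d be positive integers, let Q be a real positive semidefinite N×N matrix, and let O₁, …, O_d be real orthogonal N×N matrices. Then det(I + (1/(n·d))·∑_{j=1}^d Oⱼ Q Oⱼᵀ) ≥ det(I + (1/n)·Q). -/
open Matrix

/-- A positive semidefinite matrix `A` satisfies `det A ≤ exp (tr A - tr 1)`. -/
theorem Matrix.PosSemidef.det_le_exp_trace_sub_card {ι : Type*} [Fintype ι] [DecidableEq ι]
    {A : Matrix ι ι ℝ} (hA : A.PosSemidef) :
    A.det ≤ Real.exp (A.trace - Fintype.card ι) := by
  have hdet := hA.1.det_eq_prod_eigenvalues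
  have htr := hA.1.trace_eq_sum_eigenvalues
  simp only [RCLike.ofReal_real_eq_id, id_eq] at hdet htr
  have hsum : A.trace - Fintype.card ι = ∑ i, (hA.1.eigenvalues i - 1) := by
    simp [htr]
  rw [hsum, Real.exp_sum, hdet]
  refine Finset.prod_le_prod (fun i _ ↦ hA.eigenvalues_nonneg i) fun i _ ↦ ?_
  linarith [Real.add_one_le_exp (hA.1.eigenvalues i - 1)]

open scoped MatrixOrder Matrix.Norms.L2Operator in
/-- If finitely many positive semidefinite matrices share the same determinant, that determinant
is at most the determinant of their average, provided the average is positive definite. -/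
theorem Matrix.PosDef.le_det_of_sum_eq_card_smul {ι κ : Type*} [Fintype ι] [DecidableEq ι]
    [Fintype κ] [Nonempty κ] {M : Matrix ι ι ℝ} (hM : M.PosDef) {A : κ → Matrix ι ι ℝ}
    (hA : ∀ j, (A j).PosSemidef) (hsum : ∑ j, A j = (Fintype.card κ : ℝ) • M)
    {r : ℝ} (hr : ∀ j, (A j).det = r) : r ≤ M.det := by
  obtain ⟨B, hB⟩ : ∃ B : Matrix ι ι ℝ, M = Bᴴ * B :=
    CStarAlgebra.nonneg_iff_eq_star_mul_self.mp hM.posSemidef.nonneg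
  have hMdet : M.det = B.det * B.det := by
    rw [hB, det_mul, det_conjTranspose, star_trivial]
  have hBdet : B.det ≠ 0 := fun h ↦ hM.det_pos.ne' (by rw [hMdet, h, zero_mul])
  have hBunit : IsUnit B.det := hBdet.isUnit
  have hCMC : (B⁻¹)ᴴ * M * B⁻¹ = 1 := by
    rw [hB, mul_assoc, mul_assoc, mul_nonsing_inv _ hBunit, mul_one, ← conjTranspose_mul,
      mul_nonsing_inv _ hBunit, conjTranspose_one]
  have htrace : ∑ j, ((B⁻¹)ᴴ * A j * B⁻¹).trace ≤ ∑ _j : κ, (Fintype.card ι : ℝ) := by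
    rw [← trace_sum, ← Finset.sum_mul, ← Finset.mul_sum, hsum, mul_smul_comm, smul_mul_assoc, hCMC]
    simp
  obtain ⟨j, -, hj⟩ := Finset.exists_le_of_sum_le Finset.univ_nonempty htrace
  have hle := ((hA j).conjTranspose_mul_mul_same B⁻¹).det_le_exp_trace_sub_card.trans
    (Real.exp_le_one_iff.mpr (sub_nonpos.mpr hj))
  rw [det_mul, det_mul, det_conjTranspose, star_trivial, det_nonsing_inv, hr,
    Ring.inverse_eq_inv'] at hle
  have hpos := hM.det_pos
  calc r = (B.det⁻¹ * r * B.det⁻¹) * M.det := by rw [hMdet]; field_simp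
    _ ≤ 1 * M.det := by gcongr
    _ = M.det := one_mul _

/-- Averaged-conjugation determinant inequality: if `Q` is real positive
semidefinite and `O₁, …, O_d` are orthogonal, then
`det (I + (1/(n·d)) • ∑ⱼ Oⱼ Q Oⱼᵀ) ≥ det (I + (1/n) • Q)`. -/
theorem det_avg_conj_ge (N n d : ℕ) (hN : 0 < N) (hn : 0 < n) (hd : 0 < d)
    (Q : Matrix (Fin N) (Fin N) ℝ) (hQ : Q.PosSemidef)
    (O : Fin d → Matrix (Fin N) (Fin N) ℝ)
    (hO : ∀ j, (O j)ᵀ * O j = 1) :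
    (1 + ((n : ℝ) * d)⁻¹ • ∑ j, O j * Q * (O j)ᵀ).det ≥
      (1 + ((n : ℝ))⁻¹ • Q).det := by
  have : Nonempty (Fin d) := ⟨⟨0, hd⟩⟩
  have hd' : (d : ℝ) ≠ 0 := by positivity
  have hconj (j : Fin d) : (O j * Q * (O j)ᵀ).PosSemidef := hQ.mul_mul_conjTranspose_same (O j)
  refine PosDef.le_det_of_sum_eq_card_smul (A := fun j ↦ 1 + (n : ℝ)⁻¹ • (O j * Q * (O j)ᵀ))
    (PosDef.one.add_posSemidef ((posSemidef_sum _ fun j _ ↦ hconj j).smul (by positivity)))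
    (fun j ↦ PosSemidef.one.add ((hconj j).smul (by positivity))) ?_ fun j ↦ ?_
  · rw [Finset.sum_add_distrib, ← Finset.smul_sum, smul_add, smul_smul, mul_inv]
    simp [mul_left_comm, hd', Nat.cast_smul_eq_nsmul]
  · have hO' : O j * (O j)ᵀ = 1 := mul_eq_one_comm.mp (hO j)
    have hfactor : 1 + (n : ℝ)⁻¹ • (O j * Q * (O j)ᵀ)
        = O j * (1 + (n : ℝ)⁻¹ • Q) * (O j)ᵀ := by
      rw [mul_add, add_mul, mul_one, hO', mul_smul_comm, smul_mul_assoc]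
    rw [hfactor, det_mul_right_comm, hO', one_mul]
end

section
/- Let N and n be positive integers and let Q be a real positive semidefinite N×N matrix with trace(Q) = N. Then det(I + (1/n)·Q) ≥ ((n+1)/n)^N · (det Q)^{1/(n+1)}, and equality holds if and only if Q = I. -/
theorem Matrix.IsHermitian.det_one_add_smul_eq_prod {ι : Type*} [Fintype ι] [DecidableEq ι]
    {A : Matrix ι ι ℝ} (hA : A.IsHermitian) (c : ℝ) :
    (1 + c • A).det = ∏ i, (1 + c * hA.eigenvalues i) := by
  have h : 1 + c • A = Unitary.conjStarAlgAut ℝ _ hA.eigenvectorUnitary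
      (Matrix.diagonal fun i => 1 + c * hA.eigenvalues i) := by
    have hd : (Matrix.diagonal fun i => 1 + c * hA.eigenvalues i) =
        1 + c • Matrix.diagonal (RCLike.ofReal ∘ hA.eigenvalues : ι → ℝ) := by
      rw [← Matrix.diagonal_one, ← Matrix.diagonal_smul, Matrix.diagonal_add]
      rfl
    rw [hd, map_add, map_one, map_smul, ← hA.spectral_theorem]
  rw [h, Unitary.conjStarAlgAut_apply, Matrix.det_mul_right_comm]
  simp

theorem Matrix.IsHermitian.eq_one_of_eigenvalues_eq_one {ι : Type*} [Fintype ι] [DecidableEq ι]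
    {A : Matrix ι ι ℝ} (hA : A.IsHermitian) (h : ∀ i, hA.eigenvalues i = 1) : A = 1 := by
  have hd : Matrix.diagonal (RCLike.ofReal ∘ hA.eigenvalues : ι → ℝ) = 1 := by
    rw [← Matrix.diagonal_one]
    congr 1
    ext i
    simp [h i]
  rw [hA.spectral_theorem, hd, map_one]

theorem mul_rpow_lt_one_add_inv_mul {a x : ℝ} (ha : 0 < a) (hx : 0 ≤ x) (hx1 : x ≠ 1) :
    (a + 1) / a * x ^ (1 / (a + 1)) < 1 + a⁻¹ * x := by
  have h := rpow_one_add_lt_one_add_mul_self (s := x - 1) (p := 1 / (a + 1))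
    (by linarith) (sub_ne_zero.mpr hx1) (by positivity)
    ((div_lt_one (by positivity)).mpr (by linarith))
  rw [add_sub_cancel] at h
  calc (a + 1) / a * x ^ (1 / (a + 1))
      < (a + 1) / a * (1 + 1 / (a + 1) * (x - 1)) := by gcongr
    _ = 1 + a⁻¹ * x := by field_simp; ring

theorem mul_rpow_le_one_add_inv_mul {a x : ℝ} (ha : 0 < a) (hx : 0 ≤ x) :
    (a + 1) / a * x ^ (1 / (a + 1)) ≤ 1 + a⁻¹ * x := by
  rcases eq_or_ne x 1 with rfl | hx1
  · rw [Real.one_rpow]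
    exact le_of_eq (by field_simp)
  · exact (mul_rpow_lt_one_add_inv_mul ha hx hx1).le

/-- If `Q` is real positive semidefinite with `trace Q = N`, then
`det (I + (1/n) • Q) ≥ ((n+1)/n)^N * (det Q)^(1/(n+1))`, with equality
iff `Q = I`. -/
theorem det_one_add_smul_ge_rpow (N n : ℕ) (hN : 0 < N) (hn : 0 < n)
    (Q : Matrix (Fin N) (Fin N) ℝ) (hQ : Q.PosSemidef)
    (htr : Q.trace = N) :
    ((n + 1 : ℝ) / n) ^ N * Q.det ^ ((1 : ℝ) / (n + 1)) ≤
        (1 + ((n : ℝ))⁻¹ • Q).det ∧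
      ((1 + ((n : ℝ))⁻¹ • Q).det =
          ((n + 1 : ℝ) / n) ^ N * Q.det ^ ((1 : ℝ) / (n + 1)) ↔ Q = 1) := by
  have hn' : (0 : ℝ) < n := by exact_mod_cast hn
  have hnonneg := hQ.eigenvalues_nonneg
  set l := hQ.isHermitian.eigenvalues
  have hdet : Q.det = ∏ i, l i := by simpa using hQ.isHermitian.det_eq_prod_eigenvalues
  have hrhs : ((n + 1 : ℝ) / n) ^ N * Q.det ^ ((1 : ℝ) / (n + 1)) =
      ∏ i, ((n + 1 : ℝ) / n * l i ^ ((1 : ℝ) / (n + 1))) := by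
    rw [Finset.prod_mul_distrib, Real.finsetProd_rpow _ _ fun i _ => hnonneg i, hdet,
      Finset.prod_const, Finset.card_univ, Fintype.card_fin]
  have hle : ∀ i ∈ Finset.univ, (n + 1 : ℝ) / n * l i ^ ((1 : ℝ) / (n + 1)) ≤
      1 + (n : ℝ)⁻¹ * l i := fun i _ => mul_rpow_le_one_add_inv_mul hn' (hnonneg i)
  rw [hrhs, hQ.isHermitian.det_one_add_smul_eq_prod]
  refine ⟨Finset.prod_le_prod (fun i _ => ?_) hle, fun heq => ?_, fun hQ1 => ?_⟩
  · have := hnonneg i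
    positivity
  · refine hQ.isHermitian.eq_one_of_eigenvalues_eq_one fun i => ?_
    by_contra hi
    refine heq.not_gt ?_
    by_cases hpos : ∀ j, 0 < l j
    · refine Finset.prod_lt_prod (fun j _ => ?_) hle
        ⟨i, Finset.mem_univ i, mul_rpow_lt_one_add_inv_mul hn' (hnonneg i) hi⟩
      have := hpos j
      positivity
    · obtain ⟨j, hj⟩ := not_forall.mp hpos
      have hj0 : l j = 0 := le_antisymm (not_lt.mp hj) (hnonneg j)
      rw [Finset.prod_eq_zero (Finset.mem_univ j)
        (by rw [hj0, Real.zero_rpow (by positivity), mul_zero])]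
      refine Finset.prod_pos fun k _ => ?_
      have := hnonneg k
      positivity
  · rw [← hrhs, ← hQ.isHermitian.det_one_add_smul_eq_prod, hQ1, Matrix.det_one, Real.one_rpow,
      mul_one, show (1 : Matrix (Fin N) (Fin N) ℝ) + (n : ℝ)⁻¹ • 1 = ((n + 1 : ℝ) / n) • 1 by
        rw [add_div, div_self hn'.ne', add_smul, one_smul, one_div], Matrix.det_smul]
    simp
end

section
/- Let N and n be positive integers and let Q be a real positive semidefinite N×N matrix with trace(Q) = N. Then ((n+1)/n)^N · (det Q)^{1/2} ≤ det(I + (1/n)·Q). -/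
namespace Matrix

theorem IsHermitian.det_one_add_smul_eq_prod_s9 {ι : Type*} [Fintype ι] [DecidableEq ι]
    {A : Matrix ι ι ℝ} (hA : A.IsHermitian) (c : ℝ) :
    (1 + c • A).det = ∏ i, (1 + c * hA.eigenvalues i) := by
  have h : 1 + c • A = Unitary.conjStarAlgAut ℝ _ hA.eigenvectorUnitary
      (diagonal fun i => 1 + c * hA.eigenvalues i) := by
    have hd : (diagonal fun i => 1 + c * hA.eigenvalues i) =
        1 + c • diagonal (RCLike.ofReal ∘ hA.eigenvalues : ι → ℝ) := by
      rw [← diagonal_one, ← diagonal_smul, diagonal_add]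
      rfl
    rw [hd, map_add, map_one, map_smul, ← hA.spectral_theorem]
  rw [h, Unitary.conjStarAlgAut_apply, det_mul_comm, ← mul_assoc]
  simp

theorem PosSemidef.det_le_one_of_trace_eq_card {ι : Type*} [Fintype ι] [DecidableEq ι]
    {A : Matrix ι ι ℝ} (hA : A.PosSemidef) (htr : A.trace = Fintype.card ι) :
    A.det ≤ 1 := by
  have hsum := hA.isHermitian.trace_eq_sum_eigenvalues
  rw [htr] at hsum
  rw [hA.isHermitian.det_eq_prod_eigenvalues]
  calc ∏ i, (hA.isHermitian.eigenvalues i : ℝ)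
      ≤ ∏ i, Real.exp (hA.isHermitian.eigenvalues i - 1) := by
        refine Finset.prod_le_prod (fun i _ => hA.eigenvalues_nonneg i) fun i _ => ?_
        have := Real.add_one_le_exp (hA.isHermitian.eigenvalues i - 1)
        simpa using this
    _ = 1 := by
        rw [← Real.exp_sum, Finset.sum_sub_distrib]
        simp only [RCLike.ofReal_real_eq_id, id_eq] at hsum
        simp [← hsum]

end Matrix

/-- Weighted AM-GM for the numbers `1` and `x` with weights `n / (n + 1)` and `1 / (n + 1)`. -/
theorem Real.succ_div_mul_rpow_le_one_add {n x : ℝ} (hn : 0 < n) (hx : 0 ≤ x) :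
    (n + 1) / n * x ^ (1 / (n + 1)) ≤ 1 + n⁻¹ * x := by
  have h := Real.geom_mean_le_arith_mean2_weighted (w₁ := n / (n + 1)) (w₂ := 1 / (n + 1))
    (by positivity) (by positivity) zero_le_one hx (by field_simp)
  rw [Real.one_rpow, one_mul] at h
  calc (n + 1) / n * x ^ (1 / (n + 1))
      ≤ (n + 1) / n * (n / (n + 1) * 1 + 1 / (n + 1) * x) := by gcongr
    _ = 1 + n⁻¹ * x := by field_simp

/-- If `Q` is real positive semidefinite with `trace Q = N`, then
`((n+1)/n)^N * (det Q)^(1/2) ≤ det (I + (1/n) • Q)`. -/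
theorem det_rpow_half_le_det_one_add_smul (N n : ℕ) (hN : 0 < N) (hn : 0 < n)
    (Q : Matrix (Fin N) (Fin N) ℝ) (hQ : Q.PosSemidef)
    (htr : Q.trace = N) :
    ((n + 1 : ℝ) / n) ^ N * Q.det ^ ((1 : ℝ) / 2) ≤
      (1 + ((n : ℝ))⁻¹ • Q).det := by
  have hn1 : (1 : ℝ) ≤ n := by exact_mod_cast hn
  have hn0 : (0 : ℝ) < n := by linarith
  calc ((n + 1 : ℝ) / n) ^ N * Q.det ^ ((1 : ℝ) / 2)
      ≤ ((n + 1 : ℝ) / n) ^ N * Q.det ^ (1 / (n + 1 : ℝ)) := by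
        refine mul_le_mul_of_nonneg_left ?_ (by positivity)
        exact Real.rpow_le_rpow_of_exponent_ge' hQ.det_nonneg
          (hQ.det_le_one_of_trace_eq_card (by simpa using htr)) (by positivity)
          (one_div_le_one_div_of_le two_pos (by linarith))
    _ = ∏ i, ((n + 1 : ℝ) / n * hQ.isHermitian.eigenvalues i ^ (1 / (n + 1 : ℝ))) := by
        rw [Finset.prod_mul_distrib, Real.finsetProd_rpow _ _ fun i _ => hQ.eigenvalues_nonneg i,
          hQ.isHermitian.det_eq_prod_eigenvalues, Finset.prod_const, Finset.card_univ,
          Fintype.card_fin]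
        rfl
    _ ≤ ∏ i, (1 + (n : ℝ)⁻¹ * hQ.isHermitian.eigenvalues i) :=
        Finset.prod_le_prod
          (fun i _ => mul_nonneg (by positivity) (Real.rpow_nonneg (hQ.eigenvalues_nonneg i) _))
          fun i _ => Real.succ_div_mul_rpow_le_one_add hn0 (hQ.eigenvalues_nonneg i)
    _ = (1 + (n : ℝ)⁻¹ • Q).det := (hQ.isHermitian.det_one_add_smul_eq_prod_s9 _).symm
end

section
/- For every positive integer n and every real R > 0 there exists a constant K > 0 such that: for all real n×n matrices H₁, H₂ with trace(H₁) = trace(H₂) = 0 and operator norms ‖H₁‖ ≤ R and ‖H₂‖ ≤ R, one has |det(I + H₁ + H₂) − det(I + H₁)| ≤ K · ‖H₂‖ · (‖H₁‖ + ‖H₂‖). -/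
/-- The operator norm of a real square matrix, i.e. the norm of the induced
linear map on Euclidean space (the supremum of `‖H v‖` over unit vectors `v`). -/
noncomputable def matrixOpNorm {n : ℕ} (H : Matrix (Fin n) (Fin n) ℝ) : ℝ :=
  ‖Matrix.toEuclideanCLM (𝕜 := ℝ) H‖

section NormBounds

variable {E F : Type*} [NormedAddCommGroup E] [NormedSpace ℝ E] [FiniteDimensional ℝ E]
  [NormedAddCommGroup F] [NormedSpace ℝ F]

/-- The derivative of a `C²` function with a critical point at `0` grows at most linearly on
closed balls around `0`. -/
lemma ContDiff.exists_norm_fderiv_le_mul_norm {f : E → F} (hf : ContDiff ℝ 2 f)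
    (h₀ : fderiv ℝ f 0 = 0) {r : ℝ} (hr : 0 ≤ r) :
    ∃ K > (0 : ℝ), ∀ x : E, ‖x‖ ≤ r → ‖fderiv ℝ f x‖ ≤ K * ‖x‖ := by
  have hf' : ContDiff ℝ 1 (fderiv ℝ f) := hf.fderiv_right (by norm_num)
  have : ProperSpace E := FiniteDimensional.proper ℝ E
  obtain ⟨C, hC⟩ := (isCompact_closedBall (0 : E) r).exists_bound_of_continuousOn
    (hf'.continuous_fderiv one_ne_zero).continuousOn
  refine ⟨max C 1, by positivity, fun x hx ↦ ?_⟩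
  have h := (convex_closedBall (0 : E) r).norm_image_sub_le_of_norm_fderiv_le (𝕜 := ℝ)
    (fun y _ ↦ hf'.differentiable one_ne_zero y)
    (fun y hy ↦ (hC y hy).trans (le_max_left C 1))
    (Metric.mem_closedBall_self hr) (mem_closedBall_zero_iff.mpr hx)
  simpa [h₀] using h

/-- A `C²` function with a critical point at `0` satisfies a second-order increment bound on
closed balls around `0`. -/
lemma ContDiff.exists_norm_sub_le_of_fderiv_eq_zero {f : E → F} (hf : ContDiff ℝ 2 f)
    (h₀ : fderiv ℝ f 0 = 0) {r : ℝ} (hr : 0 ≤ r) :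
    ∃ K > (0 : ℝ), ∀ x y : E, ‖x‖ ≤ r → ‖y‖ ≤ r →
      ‖f (x + y) - f x‖ ≤ K * ‖y‖ * (‖x‖ + ‖y‖) := by
  obtain ⟨K, hK, hbound⟩ :=
    hf.exists_norm_fderiv_le_mul_norm h₀ (r := r + r) (by positivity)
  refine ⟨K, hK, fun x y hx hy ↦ ?_⟩
  have h := (convex_closedBall (0 : E) (‖x‖ + ‖y‖)).norm_image_sub_le_of_norm_fderiv_le
    (𝕜 := ℝ) (f := f) (C := K * (‖x‖ + ‖y‖)) (x := x) (y := x + y)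
    (fun z _ ↦ hf.differentiable two_ne_zero z)
    (fun z hz ↦ by
      rw [mem_closedBall_zero_iff] at hz
      exact (hbound z (by linarith)).trans (by gcongr))
    (by simp) (mem_closedBall_zero_iff.mpr (norm_add_le x y))
  rw [add_sub_cancel_left] at h
  linarith

end NormBounds

section Determinant

open scoped Matrix.Norms.L2Operator

variable {m : Type*} [Fintype m] [DecidableEq m]

lemma Matrix.contDiff_det {k : WithTop ℕ∞} :
    ContDiff ℝ k (fun A : Matrix m m ℝ ↦ A.det) := by
  have hentry (i j : m) : ContDiff ℝ k (fun A : Matrix m m ℝ ↦ A i j) :=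
    (LinearMap.toContinuousLinearMap (Matrix.entryLinearMap ℝ ℝ i j)).contDiff
  simp only [Matrix.det_apply']
  exact ContDiff.sum fun σ _ ↦ contDiff_const.mul (contDiff_prod fun i _ ↦ hentry _ _)

lemma Matrix.contDiff_trace {k : WithTop ℕ∞} :
    ContDiff ℝ k (fun A : Matrix m m ℝ ↦ A.trace) :=
  (LinearMap.toContinuousLinearMap (Matrix.traceLinearMap m ℝ ℝ)).contDiff

lemma Matrix.contDiff_det_one_add_sub_trace {k : WithTop ℕ∞} :
    ContDiff ℝ k (fun A : Matrix m m ℝ ↦ (1 + A).det - A.trace) :=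
  (Matrix.contDiff_det.comp (contDiff_const.add contDiff_id)).sub Matrix.contDiff_trace

/-- The derivative of the determinant at the identity is the trace. -/
lemma Matrix.fderiv_det_one_add_sub_trace_zero :
    fderiv ℝ (fun A : Matrix m m ℝ ↦ (1 + A).det - A.trace) 0 = 0 := by
  ext A
  have hd := (Matrix.contDiff_det_one_add_sub_trace (m := m) (k := 1)).differentiable
    one_ne_zero 0
  have hline : HasLineDerivAt ℝ (fun A : Matrix m m ℝ ↦ (1 + A).det - A.trace) 0 0 A := by
    have hpoly (t : ℝ) : (1 + (0 + t • A)).det - (0 + t • A).trace =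
        1 + (Polynomial.eval t
          (1 + (Polynomial.X : Polynomial ℝ) • A.map Polynomial.C).det.divX.divX) * t ^ 2 := by
      rw [zero_add, Matrix.det_one_add_smul, Matrix.trace_smul, smul_eq_mul]
      ring
    simp only [HasLineDerivAt, hpoly]
    simpa using (((Polynomial.hasDerivAt _ (0 : ℝ)).mul (hasDerivAt_pow 2 (0 : ℝ))).const_add 1)
  exact (hd.hasFDerivAt.hasLineDerivAt A).unique hline

end Determinant

/-- For every `n` and `R > 0` there is `K > 0` such that for all trace-free real
`n × n` matrices `H₁, H₂` with operator norms at most `R`,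
`|det (I + H₁ + H₂) − det (I + H₁)| ≤ K ‖H₂‖ (‖H₁‖ + ‖H₂‖)`. -/
theorem det_perturbation_estimate (n : ℕ) (hn : 0 < n) (R : ℝ) (hR : 0 < R) :
    ∃ K > (0 : ℝ), ∀ H₁ H₂ : Matrix (Fin n) (Fin n) ℝ,
      H₁.trace = 0 → H₂.trace = 0 →
      matrixOpNorm H₁ ≤ R → matrixOpNorm H₂ ≤ R →
      |(1 + H₁ + H₂).det - (1 + H₁).det| ≤
        K * matrixOpNorm H₂ * (matrixOpNorm H₁ + matrixOpNorm H₂) := by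
  open scoped Matrix.Norms.L2Operator in
  obtain ⟨K, hK, h⟩ := (Matrix.contDiff_det_one_add_sub_trace (m := Fin n)
    ).exists_norm_sub_le_of_fderiv_eq_zero Matrix.fderiv_det_one_add_sub_trace_zero hR.le
  refine ⟨K, hK, fun H₁ H₂ ht₁ ht₂ hH₁ hH₂ ↦ ?_⟩
  have h₁₂ := h H₁ H₂ hH₁ hH₂
  simp only [Matrix.trace_add, ht₁, ht₂, add_zero, sub_zero, ← add_assoc] at h₁₂
  exact h₁₂
end

section
/- Let N ≥ 2 be an integer, let c > 0 be a real number, and let λ : Fin N → ℝ satisfy λᵢ ≥ c for every i and ∑ᵢ λᵢ = N. Then ∏ᵢ λᵢ ≤ 1 − (1/4)·c^{N−2}·(λ_max − λ_min)², where λ_max and λ_min denote the largest and smallest of the values λᵢ. -/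
theorem Finset.prod_le_exp_sum_sub_one {ι : Type*} (s : Finset ι) (f : ι → ℝ)
    (hf : ∀ i ∈ s, 0 ≤ f i) : ∏ i ∈ s, f i ≤ Real.exp (∑ i ∈ s, (f i - 1)) := by
  rw [Real.exp_sum]
  refine Finset.prod_le_prod hf fun i _ => ?_
  linarith [Real.add_one_le_exp (f i - 1)]

/-- Replacing two of the factors by their mean keeps the sum and increases the product. -/
theorem prod_le_one_sub_sq_sub_of_ne {ι : Type*} [Fintype ι] {c : ℝ} (hc : 0 < c) {f : ι → ℝ}
    (hf : ∀ i, c ≤ f i) (hsum : ∑ i, f i = Fintype.card ι) {i j : ι} (hij : i ≠ j) :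
    ∏ k, f k ≤ 1 - (1 / 4) * c ^ (Fintype.card ι - 2) * (f i - f j) ^ 2 := by
  classical
  set s := (Finset.univ.erase i).erase j with hs
  have hj : j ∈ Finset.univ.erase i := by simp [hij.symm]
  have hprod : ∏ k, f k = f i * (f j * ∏ k ∈ s, f k) := by
    rw [hs, Finset.mul_prod_erase _ _ hj, Finset.mul_prod_erase _ _ (Finset.mem_univ i)]
  have hzero : (f i - 1) + ((f j - 1) + ∑ k ∈ s, (f k - 1)) = 0 := by
    rw [hs, Finset.add_sum_erase _ (fun k => f k - 1) hj,
      Finset.add_sum_erase _ (fun k => f k - 1) (Finset.mem_univ i)]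
    simp [hsum]
  have hcard : s.card = Fintype.card ι - 2 := by
    rw [hs, Finset.card_erase_of_mem hj, Finset.card_erase_of_mem (Finset.mem_univ i),
      Finset.card_univ, Nat.sub_sub]
  have hlower : c ^ (Fintype.card ι - 2) ≤ ∏ k ∈ s, f k := by
    rw [← hcard, ← Finset.prod_const]
    exact Finset.prod_le_prod (fun _ _ => hc.le) fun k _ => hf k
  have hupper := s.prod_le_exp_sum_sub_one f fun k _ => hc.le.trans (hf k)
  set m := (f i + f j) / 2 with hm
  have hm0 : 0 ≤ m := by linarith [hf i, hf j]
  have hmexp : m ≤ Real.exp (m - 1) := by linarith [Real.add_one_le_exp (m - 1)]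
  have hmean : m * m * ∏ k ∈ s, f k ≤ 1 := by
    calc m * m * ∏ k ∈ s, f k
        ≤ Real.exp (m - 1) * Real.exp (m - 1) * Real.exp (∑ k ∈ s, (f k - 1)) := by
          gcongr
          exact Finset.prod_nonneg fun k _ => hc.le.trans (hf k)
      _ = 1 := by
          rw [← Real.exp_add, ← Real.exp_add, Real.exp_eq_one_iff]
          linarith
  have hspread := mul_le_mul_of_nonneg_right hlower (sq_nonneg (f i - f j))
  have hsplit : ∏ k, f k = m * m * ∏ k ∈ s, f k - 1 / 4 * ((∏ k ∈ s, f k) * (f i - f j) ^ 2) := by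
    rw [hprod, hm]
    ring
  linarith

/-- Eigenvalue-spread product inequality: if `λ : Fin N → ℝ` with `N ≥ 2`
satisfies `λᵢ ≥ c > 0` for all `i` and `∑ᵢ λᵢ = N`, then
`∏ᵢ λᵢ ≤ 1 − (1/4) c^(N−2) (λ_max − λ_min)²`. -/
theorem prod_le_one_sub_spread (N : ℕ) (hN : 2 ≤ N) (c : ℝ) (hc : 0 < c)
    (l : Fin N → ℝ) (hl : ∀ i, c ≤ l i) (hsum : ∑ i, l i = N) :
    ∏ i, l i ≤ 1 - (1 / 4) * c ^ (N - 2) * ((⨆ i, l i) - ⨅ i, l i) ^ 2 := by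
  have : Nonempty (Fin N) := ⟨⟨0, by omega⟩⟩
  obtain ⟨i, hi⟩ := exists_eq_ciSup_of_finite (f := l)
  obtain ⟨j, hj⟩ := exists_eq_ciInf_of_finite (f := l)
  rw [← hi, ← hj]
  by_cases hij : i = j
  · have h := Finset.univ.prod_le_exp_sum_sub_one l fun k _ => hc.le.trans (hl k)
    simpa [hij, hsum] using h
  · simpa using prod_le_one_sub_sq_sub_of_ne hc hl (by simpa using hsum) hij
end
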